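/- The function f has at most five zeros in the closed interval [0, π]; that is, the set {θ ∈ [0, π] : f(θ) = 0} has at most five elements. (Second part of Proposition 5, consistent with the quintic P having at most five real roots.) -/

import Mathlib

open Polynomial in
theorem encard_zeros_eval_cos_le_natDegree {Q : ℝ[X]} (hQ : Q ≠ 0) :
    {θ ∈ Set.Icc (0 : ℝ) Real.pi | Q.eval (Real.cos θ) = 0}.encard ≤ Q.natDegree := by
  rw [← (Real.injOn_cos.mono fun θ hθ => hθ.1).encard_image]
  calc _ ≤ (Q.roots.toFinset : Set ℝ).encard := by
        apply Set.encard_le_encard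
        rintro _ ⟨θ, hθ, rfl⟩
        simpa [hQ] using hθ.2
    _ ≤ Q.natDegree := by
        rw [Set.encard_coe_eq_coe_finsetCard]
        exact_mod_cast (Multiset.toFinset_card_le _).trans Q.card_roots'

theorem Real.cos_five_mul (θ : ℝ) :
    Real.cos (5 * θ) = 16 * Real.cos θ ^ 5 - 20 * Real.cos θ ^ 3 + 5 * Real.cos θ := by
  rw [show 5 * θ = 3 * θ + 2 * θ by ring, Real.cos_add, Real.cos_three_mul, Real.cos_two_mul,
    Real.sin_three_mul, Real.sin_two_mul]
  linear_combination (8 * Real.cos θ * (Real.sin θ ^ 2 + 1 - Real.cos θ ^ 2) - 6 * Real.cos θ) *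
    Real.sin_sq_add_cos_sq θ

/-- Proposition 5 (second part): f has at most five zeros in [0, π]. -/
theorem quintic_at_most_five_zeros (m n p q : ℝ) (hm : m < 0)
    (P : ℝ → ℝ) (hP : ∀ t, P t = t^5 + m*t^3 + n*t^2 + p*t + q)
    (u : ℝ) (hu : u = 2 * Real.sqrt (-m) / Real.sqrt 5)
    (α β γ : ℝ) (hα : α = 16*n/u^3) (hβ : β = 16*p/u^4 - 5) (hγ : γ = 16*q/u^5)
    (f : ℝ → ℝ)
    (hf : ∀ θ, f θ = α * Real.cos θ ^ 2 + β * Real.cos θ + Real.cos (5*θ) + γ) :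
    {θ ∈ Set.Icc (0:ℝ) Real.pi | f θ = 0}.encard ≤ 5 := by
  let Q : Polynomial ℝ := .C 16 * .X ^ 5 + .C (-20) * .X ^ 3 + .C α * .X ^ 2 + .C (β + 5) * .X + .C γ
  have natDegree_Q : Q.natDegree = 5 := by unfold Q; compute_degree!
  have hQ : Q ≠ 0 := by
    intro h
    simp [h] at natDegree_Q
  have eval_Q (θ : ℝ) : f θ = Q.eval (Real.cos θ) := by
    simp [Q, hf, Real.cos_five_mul]
    ring
  simpa only [eval_Q, natDegree_Q, Nat.cast_ofNat] using encard_zeros_eval_cos_le_natDegree hQ
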